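/- arXiv:2605.14743 — 4 statements merged into one kernel-verified Lean document; each statement's English description precedes it below -/
import Mathlib

section
/- Let V be a finite nonempty set, (Ω, F, ℙ) a probability space, 𝓗 a measurable space, Π : Ω → 𝓗 a measurable map, and A ∈ F. Let Γ : 𝓗 → Finset V be a candidate correspondence such that {h : u ∈ Γ(h)} is measurable for every u ∈ V, and such that Γ(Π(ω)) is nonempty for every ω ∉ A. If ℙ({ω ∉ A : |Γ(Π(ω))| ≥ 2}) > 0, then there exist two measurable admissible selectors g₁, g₂ : 𝓗 → V (i.e. gₖ(h) ∈ Γ(h) whenever Γ(h) is nonempty, for k = 1,2) and a node j ∈ V such that ℙ({ω ∉ A} ∩ {g₁(Π(ω)) = j}) ≠ ℙ({ω ∉ A} ∩ {g₂(Π(ω)) = j}). In other words, the induced node-valued transition row is not uniquely determined by the candidate correspondence when ties occur with positive probability. -/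
open MeasureTheory

/-- A finite-set-valued map whose membership sets are measurable is measurable for the discrete
σ-algebra on finite sets. -/
theorem measurable_finset_of_measurableSet_mem {α V : Type*} [MeasurableSpace α] [Finite V]
    {Γ : α → Finset V} (hΓ : ∀ u, MeasurableSet {a | u ∈ Γ a}) :
    Measurable[_, ⊤] Γ := by
  let _ : MeasurableSpace (Finset V) := ⊤
  refine measurable_to_countable' fun S ↦ ?_
  have hS : Γ ⁻¹' {S} = ⋂ u, {a | u ∈ Γ a ↔ u ∈ S} := by
    ext a
    simp [Finset.ext_iff]
  rw [hS]
  refine MeasurableSet.iInter fun u ↦ ?_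
  by_cases hu : u ∈ S
  · simpa [hu] using hΓ u
  · simp only [hu, iff_false]
    exact (hΓ u).compl

/-- **Selector nonuniqueness (Proposition: Selector-independence and nonuniqueness, part (ii)).**
If the candidate correspondence has ties (at least two candidates) with positive probability on
the non-absorbing event, then two measurable admissible selectors can induce different
node-valued transition rows. -/
theorem selector_nonuniqueness
    {Ω 𝓗 V : Type*} [MeasurableSpace Ω] [MeasurableSpace 𝓗]
    [MeasurableSpace V] [MeasurableSingletonClass V]
    [Fintype V] [Nonempty V] [LinearOrder V]
    (ℙ : Measure Ω) [IsProbabilityMeasure ℙ]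
    (Φ : Ω → 𝓗) (hΦ : Measurable Φ)
    (A : Set Ω) (hA : MeasurableSet A)
    (Γ : 𝓗 → Finset V)
    (hΓmeas : ∀ u : V, MeasurableSet {h : 𝓗 | u ∈ Γ h})
    (hΓne : ∀ ω, ω ∉ A → (Γ (Φ ω)).Nonempty)
    (hpos : 0 < ℙ {ω | ω ∉ A ∧ 2 ≤ (Γ (Φ ω)).card}) :
    ∃ (g₁ g₂ : 𝓗 → V) (j : V),
      Measurable g₁ ∧ Measurable g₂ ∧
      (∀ h, (Γ h).Nonempty → g₁ h ∈ Γ h) ∧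
      (∀ h, (Γ h).Nonempty → g₂ h ∈ Γ h) ∧
      ℙ ({ω | ω ∉ A} ∩ {ω | g₁ (Φ ω) = j}) ≠
        ℙ ({ω | ω ∉ A} ∩ {ω | g₂ (Φ ω) = j}) := by
  classical
  have hcomp (F : Finset V → V) : Measurable (F ∘ Γ) :=
    let _ : MeasurableSpace (Finset V) := ⊤
    measurable_from_top.comp (measurable_finset_of_measurableSet_mem hΓmeas)
  obtain ⟨S, hS, hSpos⟩ : ∃ S : Finset V, 2 ≤ S.card ∧ ℙ {ω | ω ∉ A ∧ Γ (Φ ω) = S} ≠ 0 := by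
    by_contra! hnull
    refine hpos.ne' (measure_mono_null (t := ⋃ S : {S : Finset V // 2 ≤ S.card},
      {ω | ω ∉ A ∧ Γ (Φ ω) = S}) ?_ (measure_iUnion_null fun S ↦ hnull S S.2))
    rintro ω ⟨hω, hcard⟩
    exact Set.mem_iUnion.2 ⟨⟨_, hcard⟩, hω, rfl⟩
  let F (T : Finset V) : V := if hT : T.Nonempty then T.min' hT else Classical.arbitrary V
  have hF (T : Finset V) (hT : T.Nonempty) : F T ∈ T := by
    simpa only [F, dif_pos hT] using T.min'_mem hT
  obtain ⟨j, hjS, hj⟩ := Finset.exists_mem_ne hS (F S)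
  let G := Function.update F S j
  have hG (T : Finset V) (hT : T.Nonempty) : G T ∈ T := by
    by_cases hTS : T = S
    · subst hTS
      simpa [G] using hjS
    · simpa [G, hTS] using hF T hT
  refine ⟨F ∘ Γ, G ∘ Γ, j, hcomp F, hcomp G, fun h ↦ hF _, fun h ↦ hG _, ?_⟩
  have hsplit : {ω | ω ∉ A} ∩ {ω | (G ∘ Γ) (Φ ω) = j} =
      ({ω | ω ∉ A} ∩ {ω | (F ∘ Γ) (Φ ω) = j}) ∪ {ω | ω ∉ A ∧ Γ (Φ ω) = S} := by
    ext ω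
    by_cases hω : Γ (Φ ω) = S <;> simp +contextual [G, hω]
  have hdisj : Disjoint ({ω | ω ∉ A} ∩ {ω | (F ∘ Γ) (Φ ω) = j})
      {ω | ω ∉ A ∧ Γ (Φ ω) = S} := by
    rw [Set.disjoint_left]
    rintro ω ⟨-, hFj⟩ ⟨-, hω⟩
    exact hj (by rw [← hω]; exact hFj.symm)
  have hmeas : MeasurableSet ({ω | ω ∉ A} ∩ {ω | (F ∘ Γ) (Φ ω) = j}) :=
    hA.compl.inter (((hcomp F).comp hΦ) (measurableSet_singleton j))
  rw [hsplit, measure_union' hdisj hmeas]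
  exact (ENNReal.lt_add_right (measure_ne_top _ _) hSpos).ne
end

section
/- Let (Ω, F, ℙ) be a probability space, V a finite nonempty set, ⊥ a distinguished absorbing symbol, and X : ℕ → Ω → V ∪ {⊥} a stochastic process with each X_t measurable. Define T := inf{t ≥ 0 : X_t = ⊥}. Assume: (S2) T < ∞ almost surely, X_0 ∈ V almost surely (so T ≥ 1 a.s.), and 1 ≤ E[T] < ∞; and (S1) there exists a probability vector p on V such that for every t ≥ 1 with ℙ(T > t) > 0 and every v ∈ V, ℙ(X_t = v | T > t) = p_v. Let s denote the law of X_0 on V, i.e. s_v = ℙ(X_0 = v). Then for every v ∈ V, the absorbing-frequency centrality b_v := E[∑_{t=0}^{T−1} 1{X_t = v}] / E[T] satisfies the mixture formula b_v = (1/E[T])·s_v + (1 − 1/E[T])·p_v. -/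
open MeasureTheory

/-- **Tail-sum formula.** For an integrable `ℕ`-valued `T`, the expected number of indices `t < T`
at which the event `A t` occurs is the sum of the probabilities `μ (A t ∩ {t < T})`. -/
theorem hasSum_measureReal_inter_lt {Ω : Type*} [MeasurableSpace Ω] {μ : Measure Ω}
    {T : Ω → ℕ} (hT : Integrable (fun ω => (T ω : ℝ)) μ)
    {A : ℕ → Set Ω} (hA : ∀ t, NullMeasurableSet (A t) μ) :
    HasSum (fun t => μ.real (A t ∩ {ω | t < T ω}))
      (∫ ω, ∑ t ∈ Finset.range (T ω), (A t).indicator (fun _ => (1 : ℝ)) ω ∂μ) := by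
  have hlt (t : ℕ) : NullMeasurableSet {ω | t < T ω} μ := by
    simpa using nullMeasurableSet_lt (aemeasurable_const (b := (t : ℝ))) hT.aemeasurable
  have hsum (B : ℕ → Set Ω) (ω : Ω) :
      HasSum (fun t => (B t ∩ {ω | t < T ω}).indicator (fun _ => (1 : ℝ)) ω)
        (∑ t ∈ Finset.range (T ω), (B t).indicator (fun _ => (1 : ℝ)) ω) := by
    have hcongr : ∑ t ∈ Finset.range (T ω), (B t).indicator (fun _ => (1 : ℝ)) ω
        = ∑ t ∈ Finset.range (T ω), (B t ∩ {ω | t < T ω}).indicator (fun _ => (1 : ℝ)) ω := by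
      refine Finset.sum_congr rfl fun t ht => ?_
      have : t < T ω := Finset.mem_range.1 ht
      by_cases h : ω ∈ B t <;> simp [h, this]
    rw [hcongr]
    refine hasSum_sum_of_ne_finset_zero fun t ht => ?_
    have : ¬ t < T ω := fun h => ht (Finset.mem_range.2 h)
    simp [this]
  have hsumT (ω : Ω) :
      HasSum (fun t => {ω | t < T ω}.indicator (fun _ => (1 : ℝ)) ω) (T ω : ℝ) := by
    simpa using hsum (fun _ => Set.univ) ω
  have hmeas (t : ℕ) : NullMeasurableSet (A t ∩ {ω | t < T ω}) μ := (hA t).inter (hlt t)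
  have key := hasSum_integral_of_dominated_convergence (μ := μ)
    (F := fun t ω => (A t ∩ {ω | t < T ω}).indicator (fun _ => (1 : ℝ)) ω)
    (fun t ω => {ω | t < T ω}.indicator (fun _ => (1 : ℝ)) ω)
    (fun t => aestronglyMeasurable_const.indicator₀ (hmeas t))
    (fun t => .of_forall fun ω => by
      by_cases h₁ : ω ∈ A t <;> by_cases h₂ : t < T ω <;> simp [h₁, h₂])
    (.of_forall fun ω => (hsumT ω).summable)
    (by simpa only [(hsumT _).tsum_eq] using hT)
    (.of_forall (hsum A))
  simpa only [integral_indicator₀ (hmeas _), setIntegral_const, smul_eq_mul, mul_one] using key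

/-- **Mixture formula for AFC (Theorem).**
Under (S2) (almost-sure absorption, `X_0 ∈ V` a.s., `1 ≤ E[T] < ∞`) and (S1) (a common
post-initial survival-conditional law `p`), the absorbing-frequency centrality satisfies
`b_v = (1/E[T])·s_v + (1 − 1/E[T])·p_v`, where `s` is the law of `X_0`. -/
theorem afc_mixture_formula
    {Ω V : Type*} [MeasurableSpace Ω] [Fintype V] [Nonempty V] [DecidableEq V]
    (ℙ : Measure Ω) [IsProbabilityMeasure ℙ]
    (X : ℕ → Ω → Option V)
    (hX : ∀ t, ∀ j : Option V, MeasurableSet {ω | X t ω = j})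
    (T : Ω → ℕ) (hT : ∀ ω, T ω = sInf {t | X t ω = none})
    (hfin : ∀ᵐ ω ∂ℙ, ∃ t, X t ω = none)
    (hstart : ∀ᵐ ω ∂ℙ, X 0 ω ≠ none)
    (hint : Integrable (fun ω => (T ω : ℝ)) ℙ)
    (hET : 1 ≤ ∫ ω, (T ω : ℝ) ∂ℙ)
    (p : V → ℝ) (hp0 : ∀ v, 0 ≤ p v) (hp1 : ∑ v, p v = 1)
    (hS1 : ∀ t : ℕ, 1 ≤ t → 0 < ℙ {ω | t < T ω} → ∀ v : V,
      (ℙ {ω | X t ω = some v ∧ t < T ω}).toReal / (ℙ {ω | t < T ω}).toReal = p v)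
    (s : V → ℝ) (hs : ∀ v, s v = (ℙ {ω | X 0 ω = some v}).toReal) :
    ∀ v : V,
      (∫ ω, (∑ t ∈ Finset.range (T ω), if X t ω = some v then (1 : ℝ) else 0) ∂ℙ)
          / (∫ ω, (T ω : ℝ) ∂ℙ)
        = (1 / ∫ ω, (T ω : ℝ) ∂ℙ) * s v
          + (1 - 1 / ∫ ω, (T ω : ℝ) ∂ℙ) * p v := by
  intro v
  have hpos : ∀ᵐ ω ∂ℙ, 0 < T ω := by
    filter_upwards [hfin, hstart] with ω hω hω₀
    rw [hT, Nat.pos_iff_ne_zero, Ne, Nat.sInf_eq_zero, not_or]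
    exact ⟨hω₀, Set.Nonempty.ne_empty hω⟩
  have hvisit := hasSum_measureReal_inter_lt hint
    (A := fun t => {ω | X t ω = some v}) fun t => (hX t (some v)).nullMeasurableSet
  have hsurv := hasSum_measureReal_inter_lt hint
    (A := fun _ => Set.univ) fun _ => nullMeasurableSet_univ
  simp only [Set.indicator_apply, Set.mem_ofPred_eq] at hvisit
  simp only [Set.univ_inter, Set.indicator_univ, Finset.sum_const, Finset.card_range,
    nsmul_eq_mul, mul_one] at hsurv
  have hsurv₀ : ℙ.real {ω | 0 < T ω} = 1 := by
    rw [measureReal_congr (Filter.eventuallyEq_univ.2 hpos), probReal_univ]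
  have hvisit₀ : ℙ.real ({ω | X 0 ω = some v} ∩ {ω | 0 < T ω}) = s v := by
    rw [hs, ← Measure.real]
    refine measureReal_congr ?_
    filter_upwards [hpos] with ω hω
    exact propext (and_iff_left hω)
  have hvisit_succ (t : ℕ) (ht : t ≠ 0) :
      ℙ.real ({ω | X t ω = some v} ∩ {ω | t < T ω}) = p v * ℙ.real {ω | t < T ω} := by
    rcases eq_or_ne (ℙ {ω | t < T ω}) 0 with h | h
    · simp [Measure.real, h, measure_inter_null_of_null_right]
    · rw [← hS1 t (Nat.one_le_iff_ne_zero.2 ht) (pos_iff_ne_zero.2 h) v]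
      exact (div_mul_cancel₀ _ (ENNReal.toReal_ne_zero.2 ⟨h, measure_ne_top _ _⟩)).symm
  have hdiff := (hvisit.sub (hsurv.mul_left (p v))).unique
    (hasSum_single 0 fun t ht => sub_eq_zero.2 (hvisit_succ t ht))
  rw [hvisit₀, hsurv₀] at hdiff
  have hne : ∫ ω, (T ω : ℝ) ∂ℙ ≠ 0 := by linarith
  field_simp
  linarith
end

section
/- Let n ≥ 1, r ∈ (0,1], and let Q⁰ and Q be n×n real matrices with nonnegative entries whose row sums satisfy ∑_j Q⁰ i j ≤ 1 − r and ∑_j Q i j ≤ 1 − r for every i, and suppose ‖Q − Q⁰‖∞ ≤ ε̄ for some ε̄ ≥ 0. Let s : Fin n → ℝ be a probability vector, and set μ := s·(I−Q)⁻¹, μ⁰ := s·(I−Q⁰)⁻¹, and for u,v ∈ Fin n define the visit-gaps G_{uv} := μ_u − μ_v and G⁰_{uv} := μ⁰_u − μ⁰_v. Then ‖μ − μ⁰‖∞ ≤ ε̄/r², hence |G_{uv} − G⁰_{uv}| ≤ 2ε̄/r² for all u,v; in particular, if G⁰_{uv} > 2ε̄/r², then G_{uv} > 0, i.e. the nominal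 ranking of u over v is preserved under every such perturbation. -/
open Matrix

attribute [local instance] Matrix.linftyOpNormedRing

theorem linfty_opNorm_le_of_row_sum_le {n : ℕ} {A : Matrix (Fin n) (Fin n) ℝ} {c : ℝ}
    (hc : 0 ≤ c) (hA : ∀ i, ∑ j, |A i j| ≤ c) : ‖A‖ ≤ c := by
  lift c to NNReal using hc
  rw [Matrix.linfty_opNorm_def, NNReal.coe_le_coe]
  refine Finset.sup_le fun i _ => ?_
  rw [← NNReal.coe_le_coe]
  simpa [Real.norm_eq_abs] using hA i

theorem abs_entry_le_linfty_opNorm {n : ℕ} (A : Matrix (Fin n) (Fin n) ℝ) (i j : Fin n) :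
    |A i j| ≤ ‖A‖ := by
  have h : ∑ k, ‖A i k‖₊ ≤ Finset.univ.sup fun i => ∑ k, ‖A i k‖₊ :=
    Finset.le_sup (f := fun i => ∑ k, ‖A i k‖₊) (Finset.mem_univ i)
  have h' : ‖A i j‖₊ ≤ ∑ k, ‖A i k‖₊ :=
    Finset.single_le_sum (f := fun k => ‖A i k‖₊) (fun _ _ => zero_le) (Finset.mem_univ j)
  rw [Matrix.linfty_opNorm_def]
  exact_mod_cast h'.trans h

theorem norm_vecMul_le_linfty_opNorm {n : ℕ} (A : Matrix (Fin n) (Fin n) ℝ) {s : Fin n → ℝ}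
    (hs0 : ∀ i, 0 ≤ s i) (hs1 : ∑ i, s i = 1) : ‖s ᵥ* A‖ ≤ ‖A‖ := by
  refine (pi_norm_le_iff_of_nonneg (norm_nonneg A)).2 fun j => ?_
  calc ‖(s ᵥ* A) j‖ ≤ ∑ i, ‖s i * A i j‖ :=
        norm_sum_le Finset.univ fun i => s i * A i j
    _ ≤ ∑ i, s i * ‖A‖ := Finset.sum_le_sum fun i _ => by
        rw [norm_mul, Real.norm_of_nonneg (hs0 i)]
        exact mul_le_mul_of_nonneg_left (abs_entry_le_linfty_opNorm A i j) (hs0 i)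
    _ = ‖A‖ := by rw [← Finset.sum_mul, hs1, one_mul]

theorem isUnit_one_sub_and_norm_inv_le {n : ℕ} {r : ℝ} (hr : r ∈ Set.Ioc (0 : ℝ) 1)
    {Q : Matrix (Fin n) (Fin n) ℝ} (hQ : ∀ i j, 0 ≤ Q i j) (hrow : ∀ i, ∑ j, Q i j ≤ 1 - r) :
    IsUnit (1 - Q).det ∧ ‖(1 - Q)⁻¹‖ ≤ 1 / r := by
  have hQn : ‖Q‖ ≤ 1 - r := linfty_opNorm_le_of_row_sum_le (sub_nonneg.2 hr.2) fun i => by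
    simpa only [abs_of_nonneg (hQ i _)] using hrow i
  have hone : ‖(1 : Matrix (Fin n) (Fin n) ℝ)‖ ≤ 1 :=
    linfty_opNorm_le_of_row_sum_le zero_le_one fun i => by simp [Matrix.one_apply, apply_ite abs]
  have : @CompleteSpace (Matrix (Fin n) (Fin n) ℝ) PseudoMetricSpace.toUniformSpace :=
    inferInstanceAs (CompleteSpace (Fin n → Fin n → ℝ))
  have hdet : IsUnit (1 - Q).det := (Matrix.isUnit_iff_isUnit_det _).1
    (isUnit_one_sub_of_norm_lt_one (hQn.trans_lt (by linarith [hr.1])))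
  refine ⟨hdet, ?_⟩
  have hfix : (1 - Q)⁻¹ = 1 + Q * (1 - Q)⁻¹ := by
    have h := Matrix.mul_nonsing_inv _ hdet
    rw [sub_mul, one_mul] at h
    exact sub_eq_iff_eq_add.1 h
  have hle : ‖(1 - Q)⁻¹‖ ≤ 1 + (1 - r) * ‖(1 - Q)⁻¹‖ := by
    calc ‖(1 - Q)⁻¹‖ = ‖1 + Q * (1 - Q)⁻¹‖ := congrArg norm hfix
      _ ≤ ‖(1 : Matrix (Fin n) (Fin n) ℝ)‖ + ‖Q * (1 - Q)⁻¹‖ := norm_add_le _ _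
      _ ≤ 1 + (1 - r) * ‖(1 - Q)⁻¹‖ := add_le_add hone
          ((norm_mul_le _ _).trans (mul_le_mul_of_nonneg_right hQn (norm_nonneg _)))
  rw [le_div_iff₀ hr.1]
  linarith

/-- **Visit-gap stability under row-wise perturbations.**
If `Q⁰` and `Q` are nonnegative with row sums at most `1 − r` and `‖Q − Q⁰‖∞ ≤ ε̄`, then
the expected-visit vectors `μ = s·(I−Q)⁻¹` and `μ⁰ = s·(I−Q⁰)⁻¹` satisfy
`‖μ − μ⁰‖∞ ≤ ε̄/r²` (sup norm on vectors), hence all visit-gaps move by at most `2ε̄/r²`;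
in particular a nominal gap `G⁰_{uv} > 2ε̄/r²` certifies `G_{uv} > 0`. -/
theorem visit_gap_stability
    {n : ℕ} (hn : 1 ≤ n)
    (r : ℝ) (hr : r ∈ Set.Ioc (0 : ℝ) 1) (ε : ℝ) (hε : 0 ≤ ε)
    (Q0 Q : Matrix (Fin n) (Fin n) ℝ)
    (hQ00 : ∀ i j, 0 ≤ Q0 i j) (hQ0row : ∀ i, ∑ j, Q0 i j ≤ 1 - r)
    (hQ0' : ∀ i j, 0 ≤ Q i j) (hQrow : ∀ i, ∑ j, Q i j ≤ 1 - r)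
    (hpert : ‖Q - Q0‖ ≤ ε)
    (s : Fin n → ℝ) (hs0 : ∀ i, 0 ≤ s i) (hs1 : ∑ i, s i = 1) :
    ‖(s ᵥ* (1 - Q)⁻¹) - (s ᵥ* (1 - Q0)⁻¹)‖ ≤ ε / r ^ 2 ∧
    (∀ u v : Fin n,
      |((s ᵥ* (1 - Q)⁻¹) u - (s ᵥ* (1 - Q)⁻¹) v)
        - ((s ᵥ* (1 - Q0)⁻¹) u - (s ᵥ* (1 - Q0)⁻¹) v)| ≤ 2 * ε / r ^ 2) ∧
    (∀ u v : Fin n,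
      2 * ε / r ^ 2 < (s ᵥ* (1 - Q0)⁻¹) u - (s ᵥ* (1 - Q0)⁻¹) v →
      0 < (s ᵥ* (1 - Q)⁻¹) u - (s ᵥ* (1 - Q)⁻¹) v) := by
  obtain ⟨hu, hB⟩ := isUnit_one_sub_and_norm_inv_le hr hQ0' hQrow
  obtain ⟨hu0, hB0⟩ := isUnit_one_sub_and_norm_inv_le hr hQ00 hQ0row
  have hres : (1 - Q)⁻¹ - (1 - Q0)⁻¹ = (1 - Q)⁻¹ * (Q - Q0) * (1 - Q0)⁻¹ := by
    rw [← sub_sub_sub_cancel_left Q0 Q 1, mul_sub, sub_mul, Matrix.nonsing_inv_mul _ hu,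
      Matrix.mul_nonsing_inv_cancel_right _ _ hu0, one_mul]
  have hinv : ‖(1 - Q)⁻¹ - (1 - Q0)⁻¹‖ ≤ ε / r ^ 2 := by
    have hr0 := hr.1
    calc ‖(1 - Q)⁻¹ - (1 - Q0)⁻¹‖ = ‖(1 - Q)⁻¹ * (Q - Q0) * (1 - Q0)⁻¹‖ := by rw [hres]
      _ ≤ ‖(1 - Q)⁻¹‖ * ‖Q - Q0‖ * ‖(1 - Q0)⁻¹‖ := norm_mul₃_le
      _ ≤ 1 / r * ε * (1 / r) := by gcongr
      _ = ε / r ^ 2 := by ring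
  have hμ : ‖(s ᵥ* (1 - Q)⁻¹) - (s ᵥ* (1 - Q0)⁻¹)‖ ≤ ε / r ^ 2 := by
    rw [← Matrix.vecMul_sub]
    exact (norm_vecMul_le_linfty_opNorm _ hs0 hs1).trans hinv
  have hgap : ∀ u v : Fin n,
      |((s ᵥ* (1 - Q)⁻¹) u - (s ᵥ* (1 - Q)⁻¹) v)
        - ((s ᵥ* (1 - Q0)⁻¹) u - (s ᵥ* (1 - Q0)⁻¹) v)| ≤ 2 * ε / r ^ 2 := fun u v => by
    have hcoord (w : Fin n) : |(s ᵥ* (1 - Q)⁻¹) w - (s ᵥ* (1 - Q0)⁻¹) w| ≤ ε / r ^ 2 :=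
      (norm_le_pi_norm ((s ᵥ* (1 - Q)⁻¹) - (s ᵥ* (1 - Q0)⁻¹)) w).trans hμ
    rw [sub_sub_sub_comm, mul_div_assoc, two_mul]
    exact (abs_sub _ _).trans (add_le_add (hcoord u) (hcoord v))
  exact ⟨hμ, hgap, fun u v h => by linarith [(abs_le.1 (hgap u v)).1]⟩
end

section
/- Let n ≥ 1, r ∈ (0,1], and let Q and Q̂ be n×n real matrices with nonnegative entries whose row sums satisfy ∑_j Q i j ≤ 1 − r and ∑_j Q̂ i j ≤ 1 − r for every i, and suppose ‖Q̂ − Q‖∞ ≤ min{r/2, r²/(8n)}. Let s : Fin n → ℝ be a probability vector, and define μ := s·(I−Q)⁻¹, μ̂ := s·(I−Q̂)⁻¹, and the normalized occupancy vectors b := μ/(μ·𝟙) and b̂ := μ̂/(μ̂·𝟙). Then μ·𝟙 ≥ 1, μ̂·𝟙 ≥ 3/4, ‖μ̂ − μ‖₁ ≤ (2n/r²)·‖Q̂ − Q‖∞, and ‖b̂ − b‖₁ ≤ (8n/r²)·‖Q̂ − Q‖∞. -/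
open Matrix

attribute [local instance] Matrix.linftyOpNormedRing

namespace Matrix

variable {ι : Type*} [Fintype ι]

/-- The `ℓ¹` norm of a row vector grows by at most the maximal absolute row sum. -/
theorem sum_abs_vecMul_le {A : Matrix ι ι ℝ} {c : ℝ} (hA : ∀ i, ∑ j, |A i j| ≤ c) (x : ι → ℝ) :
    ∑ j, |(x ᵥ* A) j| ≤ c * ∑ i, |x i| := by
  calc ∑ j, |(x ᵥ* A) j| ≤ ∑ j, ∑ i, |x i| * |A i j| := by
        refine Finset.sum_le_sum fun j _ => ?_
        simp only [vecMul, dotProduct, ← abs_mul]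
        exact Finset.abs_sum_le_sum_abs _ _
    _ = ∑ i, |x i| * ∑ j, |A i j| := by
        rw [Finset.sum_comm]
        simp only [Finset.mul_sum]
    _ ≤ ∑ i, |x i| * c :=
        Finset.sum_le_sum fun i _ => mul_le_mul_of_nonneg_left (hA i) (abs_nonneg _)
    _ = c * ∑ i, |x i| := by rw [← Finset.sum_mul, mul_comm]

theorem sum_abs_row_le_linfty_opNorm (A : Matrix ι ι ℝ) [DecidableEq ι] (i : ι) :
    ∑ j, |A i j| ≤ ‖A‖ := by
  rw [linfty_opNorm_def]
  have h : ∑ j, ‖A i j‖₊ ≤ Finset.univ.sup fun i => ∑ j, ‖A i j‖₊ :=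
    Finset.le_sup (f := fun i => ∑ j, ‖A i j‖₊) (Finset.mem_univ i)
  have h' := NNReal.coe_le_coe.2 h
  simpa using h'

variable {Q : Matrix ι ι ℝ} {r : ℝ}

/-- Row multiplication by `1 - Q` shrinks the `ℓ¹` norm by a factor of at least `r`
when `Q` has absolute row sums at most `1 - r`. -/
theorem mul_sum_abs_le_sum_abs_vecMul_one_sub [DecidableEq ι]
    (hQ : ∀ i, ∑ j, |Q i j| ≤ 1 - r) (x : ι → ℝ) :
    r * ∑ i, |x i| ≤ ∑ j, |(x ᵥ* (1 - Q)) j| := by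
  have h₁ := sum_abs_vecMul_le hQ x
  have h₂ : ∑ i, |x i| ≤ ∑ j, |(x ᵥ* (1 - Q)) j| + ∑ j, |(x ᵥ* Q) j| := by
    rw [← Finset.sum_add_distrib]
    refine Finset.sum_le_sum fun j _ => ?_
    have h := abs_add_le ((x ᵥ* (1 - Q)) j) ((x ᵥ* Q) j)
    simpa [vecMul_sub] using h
  linarith

theorem isUnit_det_one_sub_of_sum_abs_row_le [DecidableEq ι] (hr : 0 < r)
    (hQ : ∀ i, ∑ j, |Q i j| ≤ 1 - r) : IsUnit (1 - Q).det := by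
  rw [isUnit_iff_ne_zero]
  intro hdet
  obtain ⟨v, hv, hv0⟩ := exists_vecMul_eq_zero_iff.2 hdet
  have h := mul_sum_abs_le_sum_abs_vecMul_one_sub hQ v
  rw [hv0] at h
  simp only [Pi.zero_apply, abs_zero, Finset.sum_const_zero] at h
  have h₀ : ∑ i, |v i| = 0 :=
    le_antisymm (nonpos_of_mul_nonpos_right h hr) (Finset.sum_nonneg fun i _ => abs_nonneg _)
  apply hv
  ext i
  simpa using (Finset.sum_eq_zero_iff_of_nonneg fun i _ => abs_nonneg (v i)).1 h₀ i
    (Finset.mem_univ i)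

/-- A minimum principle for substochastic kernels: a row vector `x` with `x (1 - Q) ≥ 0` is
nonnegative. -/
theorem nonneg_of_vecMul_one_sub_nonneg [DecidableEq ι] (hr : 0 < r) (hQ0 : ∀ i j, 0 ≤ Q i j)
    (hQ : ∀ i, ∑ j, Q i j ≤ 1 - r) {x : ι → ℝ} (hx : ∀ j, 0 ≤ (x ᵥ* (1 - Q)) j) (i : ι) :
    0 ≤ x i := by
  have hm0 : ∀ i, 0 ≤ max (-x i) 0 := fun i => le_max_right _ _
  have hm : ∀ j, max (-x j) 0 ≤ ((fun i => max (-x i) 0) ᵥ* Q) j := by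
    intro j
    have h₁ : 0 ≤ x j - ∑ i, x i * Q i j := by
      have h := hx j
      rwa [vecMul_sub, vecMul_one] at h
    have h₂ : -∑ i, x i * Q i j ≤ ∑ i, max (-x i) 0 * Q i j := by
      rw [← Finset.sum_neg_distrib]
      refine Finset.sum_le_sum fun i _ => ?_
      rw [← neg_mul]
      exact mul_le_mul_of_nonneg_right (le_max_left _ _) (hQ0 i j)
    refine max_le ?_ (Finset.sum_nonneg fun i _ => mul_nonneg (hm0 i) (hQ0 i j))
    simp only [vecMul, dotProduct]
    linarith
  have hle := (Finset.sum_le_sum fun j (_ : j ∈ Finset.univ) => (hm j).trans (le_abs_self _)).trans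
    (sum_abs_vecMul_le (c := 1 - r) (fun i => by simpa only [abs_of_nonneg (hQ0 i _)] using hQ i) _)
  simp only [abs_of_nonneg (hm0 _)] at hle
  have hsum : ∑ i, max (-x i) 0 = 0 :=
    le_antisymm (nonpos_of_mul_nonpos_right (by linarith) hr) (Finset.sum_nonneg fun i _ => hm0 i)
  have hi := (Finset.sum_eq_zero_iff_of_nonneg fun i _ => hm0 i).1 hsum i (Finset.mem_univ i)
  linarith [le_max_left (-x i) 0]

/-- The total mass of a nonnegative row vector `x` is at least that of `x (1 - Q)`. -/
theorem sum_vecMul_one_sub_le_sum [DecidableEq ι] (hQ0 : ∀ i j, 0 ≤ Q i j) {x : ι → ℝ}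
    (hx : ∀ i, 0 ≤ x i) : ∑ j, (x ᵥ* (1 - Q)) j ≤ ∑ j, x j := by
  refine Finset.sum_le_sum fun j _ => ?_
  have h : 0 ≤ (x ᵥ* Q) j := Finset.sum_nonneg fun i _ => mul_nonneg (hx i) (hQ0 i j)
  simpa [vecMul_sub] using h

end Matrix

/-- Normalizing nonnegative vectors at most doubles their `ℓ¹` distance, when the reference vector
has mass at least one. -/
theorem sum_abs_div_sum_sub_div_sum_le {ι : Type*} [Fintype ι] {x y : ι → ℝ}
    (hy : ∀ i, 0 ≤ y i) (hx1 : 1 ≤ ∑ i, x i) (hy1 : 0 < ∑ i, y i) :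
    ∑ j, |y j / (∑ i, y i) - x j / (∑ i, x i)| ≤ 2 * ∑ j, |y j - x j| := by
  set X := ∑ i, x i with hX
  set Y := ∑ i, y i with hY
  set D := ∑ j, |y j - x j| with hD
  have hX0 : 0 < X := by linarith
  have hXY : |X - Y| ≤ D := by
    rw [abs_sub_comm, hX, hY, ← Finset.sum_sub_distrib]
    exact Finset.abs_sum_le_sum_abs _ _
  calc ∑ j, |y j / Y - x j / X| ≤ ∑ j, (|y j - x j| / X + y j * (|X - Y| / (X * Y))) := by
        refine Finset.sum_le_sum fun j _ => ?_
        have h : y j / Y - x j / X = (y j - x j) / X + y j * ((X - Y) / (X * Y)) := by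
          field_simp
          ring
        rw [h]
        refine (abs_add_le _ _).trans_eq ?_
        rw [abs_div, abs_mul, abs_div, abs_of_pos hX0, abs_of_nonneg (hy j),
          abs_of_pos (mul_pos hX0 hy1)]
    _ = (D + |X - Y|) / X := by
        rw [Finset.sum_add_distrib, ← Finset.sum_div, ← Finset.sum_mul, ← hY, ← hD]
        field_simp
    _ ≤ D + |X - Y| := div_le_self (by positivity) hx1
    _ ≤ 2 * D := by linarith

/-- **Error propagation from the estimated kernel to AFC.**
If `Q` and `Q̂` are nonnegative with row sums at most `1 − r` and
`‖Q̂ − Q‖∞ ≤ min{r/2, r²/(8n)}`, then for any probability vector `s`, the expected-visit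
vectors `μ = s·(I−Q)⁻¹` and `μ̂ = s·(I−Q̂)⁻¹` satisfy `μ·𝟙 ≥ 1`, `μ̂·𝟙 ≥ 3/4`,
`‖μ̂ − μ‖₁ ≤ (2n/r²)·‖Q̂ − Q‖∞`, and the normalized occupancy vectors satisfy
`‖b̂ − b‖₁ ≤ (8n/r²)·‖Q̂ − Q‖∞`. -/
theorem afc_error_propagation
    {n : ℕ} (hn : 1 ≤ n)
    (r : ℝ) (hr : r ∈ Set.Ioc (0 : ℝ) 1)
    (Q Qhat : Matrix (Fin n) (Fin n) ℝ)
    (hQ0 : ∀ i j, 0 ≤ Q i j) (hQrow : ∀ i, ∑ j, Q i j ≤ 1 - r)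
    (hQhat0 : ∀ i j, 0 ≤ Qhat i j) (hQhatrow : ∀ i, ∑ j, Qhat i j ≤ 1 - r)
    (hpert : ‖Qhat - Q‖ ≤ min (r / 2) (r ^ 2 / (8 * n)))
    (s : Fin n → ℝ) (hs0 : ∀ i, 0 ≤ s i) (hs1 : ∑ i, s i = 1) :
    1 ≤ ∑ j, (s ᵥ* (1 - Q)⁻¹) j ∧
    (3 : ℝ) / 4 ≤ ∑ j, (s ᵥ* (1 - Qhat)⁻¹) j ∧
    ∑ j, |(s ᵥ* (1 - Qhat)⁻¹) j - (s ᵥ* (1 - Q)⁻¹) j|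
      ≤ (2 * n / r ^ 2) * ‖Qhat - Q‖ ∧
    ∑ j, |(s ᵥ* (1 - Qhat)⁻¹) j / (∑ j', (s ᵥ* (1 - Qhat)⁻¹) j')
          - (s ᵥ* (1 - Q)⁻¹) j / (∑ j', (s ᵥ* (1 - Q)⁻¹) j')|
      ≤ (8 * n / r ^ 2) * ‖Qhat - Q‖ := by
  obtain ⟨hr0, -⟩ := hr
  have hQabs : ∀ i, ∑ j, |Q i j| ≤ 1 - r := fun i => by
    simpa only [abs_of_nonneg (hQ0 i _)] using hQrow i
  have hQhatabs : ∀ i, ∑ j, |Qhat i j| ≤ 1 - r := fun i => by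
    simpa only [abs_of_nonneg (hQhat0 i _)] using hQhatrow i
  have hμ : (s ᵥ* (1 - Q)⁻¹) ᵥ* (1 - Q) = s := by
    rw [vecMul_vecMul, nonsing_inv_mul _ (isUnit_det_one_sub_of_sum_abs_row_le hr0 hQabs),
      vecMul_one]
  have hν : (s ᵥ* (1 - Qhat)⁻¹) ᵥ* (1 - Qhat) = s := by
    rw [vecMul_vecMul, nonsing_inv_mul _ (isUnit_det_one_sub_of_sum_abs_row_le hr0 hQhatabs),
      vecMul_one]
  generalize s ᵥ* (1 - Q)⁻¹ = μ at *
  generalize s ᵥ* (1 - Qhat)⁻¹ = ν at *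
  have hμ0 : ∀ i, 0 ≤ μ i :=
    nonneg_of_vecMul_one_sub_nonneg hr0 hQ0 hQrow fun j => by rw [hμ]; exact hs0 j
  have hν0 : ∀ i, 0 ≤ ν i :=
    nonneg_of_vecMul_one_sub_nonneg hr0 hQhat0 hQhatrow fun j => by rw [hν]; exact hs0 j
  have hμ1 : 1 ≤ ∑ j, μ j := by
    have h := sum_vecMul_one_sub_le_sum hQ0 hμ0
    rwa [hμ, hs1] at h
  have hν1 : 1 ≤ ∑ j, ν j := by
    have h := sum_vecMul_one_sub_le_sum hQhat0 hν0
    rwa [hν, hs1] at h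
  have hμr : r * ∑ i, |μ i| ≤ 1 := by
    have h := mul_sum_abs_le_sum_abs_vecMul_one_sub hQabs μ
    rwa [hμ, Finset.sum_congr rfl fun j _ => abs_of_nonneg (hs0 j), hs1] at h
  have hres : (ν - μ) ᵥ* (1 - Qhat) = μ ᵥ* (Qhat - Q) := by
    rw [sub_vecMul, hν, ← hμ]
    simp only [vecMul_sub, vecMul_one]
    abel
  have hdiff : r * ∑ j, |ν j - μ j| ≤ ‖Qhat - Q‖ * ∑ i, |μ i| := by
    have h := mul_sum_abs_le_sum_abs_vecMul_one_sub hQhatabs (ν - μ)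
    rw [hres] at h
    exact h.trans (sum_abs_vecMul_le (sum_abs_row_le_linfty_opNorm _) μ)
  have hδ : 0 ≤ ‖Qhat - Q‖ := norm_nonneg _
  have hn' : (1 : ℝ) ≤ n := by exact_mod_cast hn
  have hD : ∑ j, |ν j - μ j| ≤ ‖Qhat - Q‖ / r ^ 2 := by
    rw [le_div_iff₀ (by positivity)]
    calc (∑ j, |ν j - μ j|) * r ^ 2 = r * (r * ∑ j, |ν j - μ j|) := by ring
      _ ≤ r * (‖Qhat - Q‖ * ∑ i, |μ i|) := mul_le_mul_of_nonneg_left hdiff hr0.le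
      _ = ‖Qhat - Q‖ * (r * ∑ i, |μ i|) := by ring
      _ ≤ ‖Qhat - Q‖ * 1 := mul_le_mul_of_nonneg_left hμr hδ
      _ = ‖Qhat - Q‖ := mul_one _
  have hscale : ∀ c : ℝ, 0 ≤ c →
      c * (‖Qhat - Q‖ / r ^ 2) ≤ (c * n / r ^ 2) * ‖Qhat - Q‖ := fun c hc => by
    have h : 0 ≤ c * (‖Qhat - Q‖ / r ^ 2) := by positivity
    calc c * (‖Qhat - Q‖ / r ^ 2) ≤ c * (‖Qhat - Q‖ / r ^ 2) * n := le_mul_of_one_le_right h hn'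
      _ = (c * n / r ^ 2) * ‖Qhat - Q‖ := by ring
  have hq : 0 ≤ ‖Qhat - Q‖ / r ^ 2 := by positivity
  refine ⟨hμ1, by linarith, ?_, ?_⟩
  · linarith [hscale 2 (by norm_num)]
  · have h := sum_abs_div_sum_sub_div_sum_le hν0 hμ1 (by linarith)
    linarith [hscale 8 (by norm_num)]
end
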